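/- arXiv:1304.7952 — 6 statements merged into one kernel-verified Lean document; each statement's English description precedes it below -/
import Mathlib

section
/- Let ℓ ≥ 1, n ≥ 0, let m = (m⁰,…,m^{ℓ−1}) ∈ ℚ^ℓ, and let λ, μ be ℓ-multipartitions of n. For any integer d with d ≥ max(hc^λ, hc^μ) + 1, the sum of all entries of κ^d_m(λ) equals the sum of all entries of κ^d_m(μ); that is, the sum of the entries of the shifted m-symbol of size d of an ℓ-multipartition of n does not depend on the multipartition. -/
open scoped BigOperators

/-- `l` is (the list of parts of) a partition : a nonincreasing list of positive integers. -/
def IsPartitionList (l : List ℕ) : Prop := l.Pairwise (· ≥ ·) ∧ ∀ x ∈ l, 0 < x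

/-- The β-sequence of a partition `λ` (written in increasing order) :
`(λ_h, …, λ_j − j + h, …, λ_1 − 1 + h)`, where `h` is the number of parts. -/
def betaRow (l : List ℕ) : List ℚ :=
  (List.range l.length).map (fun k => (l.getD (l.length - 1 - k) 0 : ℚ) + (k : ℚ))

/-- The shift `β(t)` of a finite sequence `β` by a rational `t ≥ 0` :
`β(t) = β` if `0 ≤ t < 1`, and
`β(t) = (t−[t], t−[t]+1, …, t−1, β₁+t, …, β_k+t)` if `t ≥ 1`. -/
def shiftRow (β : List ℚ) (t : ℚ) : List ℚ :=
  if t < 1 then β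
  else ((List.range (Int.toNat ⌊t⌋)).map (fun j => t - (⌊t⌋ : ℚ) + (j : ℚ))) ++
    β.map (· + t)

/-- The row `Bⁱ = βⁱ(d − hcⁱ)` of the shifted `m`-symbol of size `d`,
where `hcⁱ = h(λ^{i+1}) − mⁱ`. -/
def symbolRow (d : ℤ) (m : ℚ) (l : List ℕ) : List ℚ :=
  shiftRow (betaRow l) ((d : ℚ) - (l.length : ℚ) + m)

/-- `κ^d_m(λ)` : all the entries of the shifted `m`-symbol of size `d` of the
`ℓ`-multipartition `λ`, written in nonincreasing order. -/
def kappa (ℓ : ℕ) (d : ℤ) (m : Fin ℓ → ℚ) (lam : Fin ℓ → List ℕ) : List ℚ :=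
  List.insertionSort (fun a b : ℚ => b ≤ a)
    ((List.finRange ℓ).flatMap (fun i => symbolRow d (m i) (lam i)))

/-- Dominance (pre)order on finite rational sequences : every partial sum of `a`
is at most the corresponding partial sum of `b`. -/
def domLE (a b : List ℚ) : Prop :=
  ∀ i : ℕ, ∑ k ∈ Finset.range i, a.getD k 0 ≤ ∑ k ∈ Finset.range i, b.getD k 0

/-- Strict dominance `a ⊲ b`. -/
def domLT (a b : List ℚ) : Prop := domLE a b ∧ a ≠ b

theorem List.sum_map_range_eq_sum {M : Type*} [AddCommMonoid M] (f : ℕ → M) (n : ℕ) :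
    ((List.range n).map f).sum = ∑ k ∈ Finset.range n, f k := by
  induction n with
  | zero => simp
  | succ n ih => simp [List.range_succ, Finset.sum_range_succ, ih]

theorem List.sum_range_getD (l : List ℕ) :
    ∑ k ∈ Finset.range l.length, (l.getD k 0 : ℚ) = (l.sum : ℚ) := by
  induction l with
  | nil => simp
  | cons a l ih =>
    rw [List.length_cons, Finset.sum_range_succ']
    simp only [List.getD_cons_succ, List.getD_cons_zero, ih, List.sum_cons]
    push_cast
    ring

/-- The sum of a row, shifted by some `t ≥ 1`, depends on the partition only through its size. -/
theorem sum_symbolRow (d : ℤ) (m : ℚ) (l : List ℕ) (h : (l.length : ℚ) - m + 1 ≤ d) :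
    (symbolRow d m l).sum =
      l.sum + ∑ j ∈ Finset.range ⌊(d : ℚ) + m⌋.toNat, (Int.fract ((d : ℚ) + m) + j) := by
  have ht : ¬ ((d : ℚ) - l.length + m < 1) := by linarith
  have hx : (d : ℚ) - l.length + m = ((d : ℚ) + m) - (l.length : ℕ) := by ring
  have hfloor : ⌊(d : ℚ) - l.length + m⌋ = ⌊(d : ℚ) + m⌋ - l.length := by
    rw [hx, Int.floor_sub_natCast]
  have hpos : 1 ≤ ⌊(d : ℚ) - l.length + m⌋ := Int.le_floor.mpr (by push_cast; linarith)
  obtain ⟨N, hN⟩ : ∃ N : ℕ, ⌊(d : ℚ) + m⌋ = ((N + l.length : ℕ) : ℤ) :=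
    ⟨⌊(d : ℚ) - l.length + m⌋.toNat, by push_cast; omega⟩
  have hfloor' : ⌊(d : ℚ) - l.length + m⌋ = (N : ℤ) := by rw [hfloor, hN]; push_cast; ring
  have hfract : Int.fract ((d : ℚ) + m) = (d : ℚ) + m - (N + l.length) := by
    rw [Int.fract, hN]; push_cast; ring
  have hrefl : ∑ k ∈ Finset.range l.length, (l.getD (l.length - 1 - k) 0 : ℚ) = l.sum := by
    rw [Finset.sum_range_reflect (fun k => (l.getD k 0 : ℚ)), List.sum_range_getD]
  have hcast (L : List ℕ) : (do let a ← L; pure (a : ℚ)) = L.map (Nat.cast : ℕ → ℚ) := by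
    simp only [List.bind_eq_flatMap, List.pure_def, List.map_eq_flatMap]
  rw [symbolRow, shiftRow, if_neg ht, List.sum_append, betaRow, hcast, List.map_map,
    List.map_map, List.sum_map_range_eq_sum, List.sum_map_range_eq_sum, hfloor', hfract, hN,
    Int.toNat_natCast, Int.toNat_natCast, Finset.sum_range_add, ← hrefl, add_left_comm,
    ← Finset.sum_add_distrib]
  congr 1
  · refine Finset.sum_congr rfl fun j _ => ?_
    simp only [Function.comp_apply]
    push_cast
    ring
  · refine Finset.sum_congr rfl fun k _ => ?_
    simp only [Function.comp_apply]
    push_cast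
    ring

theorem sum_kappa (ℓ : ℕ) (d : ℤ) (m : Fin ℓ → ℚ) (lam : Fin ℓ → List ℕ) :
    (kappa ℓ d m lam).sum = ∑ i, (symbolRow d (m i) (lam i)).sum := by
  rw [kappa, (List.perm_insertionSort _ _).sum_eq, Fin.sum_univ_def, List.flatMap,
    List.sum_flatten, List.map_map]
  rfl

/-- The sum of the entries of the shifted `m`-symbol of size `d` of an
`ℓ`-multipartition of `n` does not depend on the multipartition. -/
theorem statement10 (ℓ n : ℕ) (hℓ : 1 ≤ ℓ) (m : Fin ℓ → ℚ) (d : ℤ)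
    (lam mu : Fin ℓ → List ℕ)
    (hlam : ∀ i, IsPartitionList (lam i)) (hmu : ∀ i, IsPartitionList (mu i))
    (hlamn : ∑ i, (lam i).sum = n) (hmun : ∑ i, (mu i).sum = n)
    (hdlam : ∀ i, ((lam i).length : ℚ) - m i + 1 ≤ (d : ℚ))
    (hdmu : ∀ i, ((mu i).length : ℚ) - m i + 1 ≤ (d : ℚ)) :
    (kappa ℓ d m lam).sum = (kappa ℓ d m mu).sum := by
  have hsize : ∑ i, ((lam i).sum : ℚ) = ∑ i, ((mu i).sum : ℚ) := by
    exact_mod_cast hlamn.trans hmun.symm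
  rw [sum_kappa, sum_kappa, Finset.sum_congr rfl fun i _ => sum_symbolRow d (m i) _ (hdlam i),
    Finset.sum_congr rfl fun i _ => sum_symbolRow d (m i) _ (hdmu i),
    Finset.sum_add_distrib, Finset.sum_add_distrib, hsize]
end

section
/- Let ℓ ≥ 1, n ≥ 0, m = (m⁰,…,m^{ℓ−1}) ∈ ℚ^ℓ, let λ, μ be ℓ-multipartitions of n, and let d be an integer with d ≥ max(hc^λ, hc^μ) + 1. Writing κ^d_m(λ) = (κ₁ ≥ … ≥ κ_t), define N^d_m(λ) = ℓ · Σ_{i=1}^t Σ_{j=0}^{[κᵢ]} (κᵢ − j), and similarly for μ. If κ^d_m(λ) ⊲ κ^d_m(μ) (strict dominance), then N^d_m(λ) < N^d_m(μ). -/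
open scoped BigOperators

/-- `N^d_m(λ) = ℓ · Σᵢ Σ_{j=0}^{[κᵢ]} (κᵢ − j)`, where `κ^d_m(λ) = (κ₁ ≥ … ≥ κ_t)`. -/
noncomputable def Nfun (ℓ : ℕ) (d : ℤ) (m : Fin ℓ → ℚ) (lam : Fin ℓ → List ℕ) : ℚ :=
  (ℓ : ℚ) *
    ((kappa ℓ d m lam).map (fun x => ∑ j ∈ Finset.Icc (0 : ℤ) ⌊x⌋, (x - (j : ℚ)))).sum

/-- On nonnegative rationals, the contribution of `x` to `N` is `(x² + x) / 2` up to a term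
depending only on the fractional part of `x`. -/
lemma sum_Icc_floor_sub {x : ℚ} (hx : 0 ≤ x) :
    ∑ j ∈ Finset.Icc (0 : ℤ) ⌊x⌋, (x - (j : ℚ)) =
      (x ^ 2 + x) / 2 + (Int.fract x - Int.fract x ^ 2) / 2 := by
  have key : ∀ k : ℕ, ∑ j ∈ Finset.Icc (0 : ℤ) k, (x - (j : ℚ)) = (k + 1) * (x - k / 2) := by
    intro k
    induction k with
    | zero => simp
    | succ k ih =>
      have h : Finset.Icc (0 : ℤ) ((k + 1 : ℕ) : ℤ) =
          insert ((k + 1 : ℕ) : ℤ) (Finset.Icc 0 (k : ℤ)) := by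
        ext j
        simp only [Finset.mem_insert, Finset.mem_Icc]
        omega
      rw [h, Finset.sum_insert (by simp), ih]
      push_cast
      ring
  obtain ⟨k, hk⟩ := Int.eq_ofNat_of_zero_le (Int.floor_nonneg.mpr hx)
  rw [hk, key]
  have hf : Int.fract x = x - k := by rw [Int.fract, hk]; simp
  rw [hf]
  ring

lemma betaRow_nonneg (l : List ℕ) : ∀ x ∈ betaRow l, 0 ≤ x := by
  intro x hx
  obtain ⟨k, -, rfl⟩ := List.mem_map.mp hx
  positivity

lemma shiftRow_of_one_le (β : List ℚ) {t : ℚ} (ht : 1 ≤ t) :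
    shiftRow β t = (List.range ⌊t⌋.toNat).map (fun j : ℕ => t - (⌊t⌋ : ℚ) + (j : ℚ)) ++
      β.map (· + t) := by
  rw [shiftRow, if_neg ht.not_gt]
  congr 1
  simp [List.map_eq_flatMap, List.flatMap_assoc]

lemma shiftRow_nonneg {β : List ℚ} (hβ : ∀ x ∈ β, 0 ≤ x) (t : ℚ) :
    ∀ x ∈ shiftRow β t, 0 ≤ x := by
  intro x hx
  rcases lt_or_ge t 1 with ht | ht
  · rw [shiftRow, if_pos ht] at hx
    exact hβ x hx
  · rw [shiftRow_of_one_le β ht] at hx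
    rcases List.mem_append.mp hx with h | h
    · obtain ⟨j, -, rfl⟩ := List.mem_map.mp h
      have := Int.floor_le t
      have : (0 : ℚ) ≤ j := j.cast_nonneg
      linarith
    · obtain ⟨y, hy, rfl⟩ := List.mem_map.mp h
      have := hβ y hy
      change 0 ≤ y + t
      linarith

/-- All entries of a row of the symbol have the fractional part of the charge, and their number
does not depend on the partition. -/
lemma map_fract_symbolRow {d : ℤ} {m : ℚ} {l : List ℕ} (h : (l.length : ℚ) - m + 1 ≤ d) :
    (symbolRow d m l).map Int.fract = List.replicate ⌊(d : ℚ) + m⌋.toNat (Int.fract m) := by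
  have ht : 1 ≤ (d : ℚ) - l.length + m := by linarith
  have hfr : Int.fract ((d : ℚ) - l.length + m) = Int.fract m := by
    have : (d : ℚ) - l.length + m = ((d - l.length : ℤ) : ℚ) + m := by push_cast; ring
    rw [this, Int.fract_intCast_add]
  rw [symbolRow, shiftRow_of_one_le _ ht, List.eq_replicate_iff]
  constructor
  · have hfl : ⌊(d : ℚ) + m⌋ = ⌊(d : ℚ) - l.length + m⌋ + l.length := by
      rw [← Int.floor_add_natCast]
      congr 1
      ring
    have h0 : 0 ≤ ⌊(d : ℚ) - l.length + m⌋ := Int.floor_nonneg.mpr (by linarith)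
    simp only [betaRow, List.length_map, List.length_append, List.length_range]
    omega
  · intro x hx
    obtain ⟨y, hy, rfl⟩ := List.mem_map.mp hx
    rcases List.mem_append.mp hy with hy | hy
    · obtain ⟨j, -, rfl⟩ := List.mem_map.mp hy
      rw [Int.fract_add_natCast, Int.fract_sub_intCast, hfr]
    · obtain ⟨z, hz, rfl⟩ := List.mem_map.mp hy
      obtain ⟨k, -, rfl⟩ := List.mem_map.mp hz
      rw [← Nat.cast_add, Int.fract_natCast_add, hfr]

lemma kappa_perm (ℓ : ℕ) (d : ℤ) (m : Fin ℓ → ℚ) (lam : Fin ℓ → List ℕ) :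
    (kappa ℓ d m lam).Perm
      ((List.finRange ℓ).flatMap (fun i => symbolRow d (m i) (lam i))) :=
  List.perm_insertionSort _ _

lemma kappa_nonneg (ℓ : ℕ) (d : ℤ) (m : Fin ℓ → ℚ) (lam : Fin ℓ → List ℕ) :
    ∀ x ∈ kappa ℓ d m lam, 0 ≤ x := by
  intro x hx
  obtain ⟨i, -, hi⟩ := List.mem_flatMap.mp ((kappa_perm ℓ d m lam).mem_iff.mp hx)
  exact shiftRow_nonneg (betaRow_nonneg _) _ x hi

lemma kappa_pairwise (ℓ : ℕ) (d : ℤ) (m : Fin ℓ → ℚ) (lam : Fin ℓ → List ℕ) :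
    (kappa ℓ d m lam).Pairwise (fun a b => b ≤ a) := by
  have : Std.Total (fun a b : ℚ => b ≤ a) := ⟨fun a b => le_total b a⟩
  have : IsTrans ℚ (fun a b : ℚ => b ≤ a) := ⟨fun _ _ _ h h' => h'.trans h⟩
  exact List.pairwise_insertionSort _ _

lemma map_fract_kappa_perm {ℓ : ℕ} {d : ℤ} {m : Fin ℓ → ℚ} {lam : Fin ℓ → List ℕ}
    (h : ∀ i, ((lam i).length : ℚ) - m i + 1 ≤ (d : ℚ)) :
    ((kappa ℓ d m lam).map Int.fract).Perm
      ((List.finRange ℓ).flatMap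
        (fun i => List.replicate ⌊(d : ℚ) + m i⌋.toNat (Int.fract (m i)))) := by
  refine ((kappa_perm ℓ d m lam).map _).trans ?_
  simp only [List.map_flatMap, map_fract_symbolRow (h _)]
  exact List.Perm.refl _

lemma sum_map_eq_sum_range_getD (l : List ℚ) (f : ℚ → ℚ) :
    (l.map f).sum = ∑ i ∈ Finset.range l.length, f (l.getD i 0) := by
  induction l with
  | nil => simp
  | cons a l ih => rw [List.length_cons, Finset.sum_range_succ']; simp [ih, add_comm]

lemma getD_nonneg {l : List ℚ} (hl : ∀ x ∈ l, 0 ≤ x) (i : ℕ) : 0 ≤ l.getD i 0 := by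
  by_cases hi : i < l.length
  · rw [List.getD_eq_getElem _ _ hi]
    exact hl _ (List.getElem_mem hi)
  · rw [List.getD_eq_default _ _ (by omega)]

lemma antitone_getD {l : List ℚ} (hl : ∀ x ∈ l, 0 ≤ x) (hs : l.Pairwise (fun a b => b ≤ a)) :
    Antitone (fun i => l.getD i 0) := by
  refine antitone_nat_of_succ_le fun i => ?_
  by_cases hi : i + 1 < l.length
  · rw [List.getD_eq_getElem _ _ hi, List.getD_eq_getElem _ _ (by omega)]
    exact List.pairwise_iff_getElem.mp hs _ _ _ _ (by omega)
  · rw [List.getD_eq_default _ _ (by omega)]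
    exact getD_nonneg hl i

/-- Abel summation: weighting by a nonincreasing sequence a sequence with nonnegative partial
sums. -/
lemma mul_sum_le_sum_mul_of_antitone {a c : ℕ → ℚ} (ha : Antitone a)
    (hc : ∀ n, 0 ≤ ∑ i ∈ Finset.range n, c i) (n : ℕ) :
    a n * ∑ i ∈ Finset.range n, c i ≤ ∑ i ∈ Finset.range n, a i * c i := by
  induction n with
  | zero => simp
  | succ n ih =>
    have h := mul_le_mul_of_nonneg_right (ha n.le_succ) (hc (n + 1))
    rw [Finset.sum_range_succ (fun i => a i * c i)]
    rw [Finset.sum_range_succ] at h ⊢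
    change a (n + 1) * _ ≤ _ at h
    linarith

/-- The sum of squares is strictly increasing for the dominance order on nonincreasing
nonnegative lists of a given length. -/
lemma sum_sq_lt_of_domLT {a b : List ℚ} (ha : ∀ x ∈ a, 0 ≤ x)
    (hs : a.Pairwise (fun x y => y ≤ x)) (hlen : a.length = b.length) (h : domLT a b) :
    (a.map (· ^ 2)).sum < (b.map (· ^ 2)).sum := by
  obtain ⟨hdom, hne⟩ := h
  rw [sum_map_eq_sum_range_getD, sum_map_eq_sum_range_getD, ← hlen]
  have hc : ∀ n, 0 ≤ ∑ i ∈ Finset.range n, (b.getD i 0 - a.getD i 0) := by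
    intro n
    rw [Finset.sum_sub_distrib]
    exact sub_nonneg.mpr (hdom n)
  have h1 := (mul_nonneg (getD_nonneg ha a.length) (hc a.length)).trans
    (mul_sum_le_sum_mul_of_antitone (antitone_getD ha hs) hc a.length)
  have h2 : 0 < ∑ i ∈ Finset.range a.length, (b.getD i 0 - a.getD i 0) ^ 2 := by
    refine (Finset.sum_nonneg fun i _ => sq_nonneg _).lt_of_ne' fun h0 => hne ?_
    rw [Finset.sum_eq_zero_iff_of_nonneg fun i _ => sq_nonneg _] at h0
    refine List.ext_getElem hlen fun i hi hi' => ?_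
    have := pow_eq_zero_iff (two_ne_zero) |>.mp (h0 i (Finset.mem_range.mpr hi))
    rw [List.getD_eq_getElem _ _ hi, List.getD_eq_getElem _ _ hi'] at this
    linarith
  have h3 : ∑ i ∈ Finset.range a.length, b.getD i 0 ^ 2 =
      ∑ i ∈ Finset.range a.length, a.getD i 0 ^ 2
        + 2 * ∑ i ∈ Finset.range a.length, a.getD i 0 * (b.getD i 0 - a.getD i 0)
        + ∑ i ∈ Finset.range a.length, (b.getD i 0 - a.getD i 0) ^ 2 := by
    rw [Finset.mul_sum, ← Finset.sum_add_distrib, ← Finset.sum_add_distrib]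
    exact Finset.sum_congr rfl fun i _ => by ring
  rw [h3]
  linarith

lemma sum_le_sum_of_domLE {a b : List ℚ} (hlen : a.length = b.length) (h : domLE a b) :
    a.sum ≤ b.sum := by
  have := h a.length
  have ha := sum_map_eq_sum_range_getD a id
  have hb := sum_map_eq_sum_range_getD b id
  rw [← hlen] at hb
  simp only [List.map_id, id] at ha hb
  rwa [ha, hb]

lemma sum_map_sum_Icc_floor {l : List ℚ} (hl : ∀ x ∈ l, 0 ≤ x) :
    (l.map (fun x => ∑ j ∈ Finset.Icc (0 : ℤ) ⌊x⌋, (x - (j : ℚ)))).sum =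
      ((l.map (· ^ 2)).sum + l.sum) / 2
        + ((l.map Int.fract).map (fun r => (r - r ^ 2) / 2)).sum := by
  induction l with
  | nil => simp
  | cons x l ih =>
    simp only [List.map_cons, List.sum_cons, sum_Icc_floor_sub (hl x List.mem_cons_self),
      ih fun y hy => hl y (List.mem_cons_of_mem _ hy)]
    ring

/-- Strict dominance between the `κ`-sequences implies strict inequality of the
corresponding `N`-functions. -/
theorem statement11 (ℓ n : ℕ) (hℓ : 1 ≤ ℓ) (m : Fin ℓ → ℚ) (d : ℤ)
    (lam mu : Fin ℓ → List ℕ)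
    (hlam : ∀ i, IsPartitionList (lam i)) (hmu : ∀ i, IsPartitionList (mu i))
    (hlamn : ∑ i, (lam i).sum = n) (hmun : ∑ i, (mu i).sum = n)
    (hdlam : ∀ i, ((lam i).length : ℚ) - m i + 1 ≤ (d : ℚ))
    (hdmu : ∀ i, ((mu i).length : ℚ) - m i + 1 ≤ (d : ℚ))
    (hdom : domLT (kappa ℓ d m lam) (kappa ℓ d m mu)) :
    Nfun ℓ d m lam < Nfun ℓ d m mu := by
  have hperm := (map_fract_kappa_perm hdlam).trans (map_fract_kappa_perm hdmu).symm
  have hlen : (kappa ℓ d m lam).length = (kappa ℓ d m mu).length := by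
    simpa using hperm.length_eq
  have hsum := sum_le_sum_of_domLE hlen hdom.1
  have hsq := sum_sq_lt_of_domLT (kappa_nonneg ℓ d m lam) (kappa_pairwise ℓ d m lam) hlen hdom
  have hfr := (hperm.map fun r => (r - r ^ 2) / 2).sum_eq
  have hpos : (0 : ℚ) < ℓ := by exact_mod_cast hℓ
  unfold Nfun
  refine mul_lt_mul_of_pos_left ?_ hpos
  rw [sum_map_sum_Icc_floor (kappa_nonneg ℓ d m lam),
    sum_map_sum_Icc_floor (kappa_nonneg ℓ d m mu), hfr]
  linarith
end

section
/- Let ℓ ≥ 1, let s = (s₀,…,s_{ℓ−1}) be an ℓ-tuple of rationals with Σᵢ sᵢ = 0 and ℓsᵢ ∈ ℤ for all i, let λ be an ℓ-multipartition of n, and let w be a permutation of {1,…,ℓ}. Define w·λ = (λ^{w⁻¹(1)},…,λ^{w⁻¹(ℓ)}) and w·s = (s'₀,…,s'_{ℓ−1}) where s'_{i−1} = s_{w⁻¹(i)−1} + (w⁻¹(i) − i)/ℓ for 1 ≤ i ≤ ℓ. Then w·s again satisfies Σᵢ s'ᵢ = 0 and ℓs'ᵢ ∈ ℤ, and τ_{w·s}(w·λ)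 = τ_s(λ). -/
open scoped BigOperators

/-- The β-set of a partition `ρ` with rational charge `s` :
`β_s(ρ)_j = ρ_{j+1} + s − j` (0-indexed). -/
def betaSetQ (ρ : List ℕ) (s : ℚ) : ℕ → ℚ := fun j => (ρ.getD j 0 : ℚ) + s - (j : ℚ)

/-- The set `𝒯 = ⋃_{i=1}^ℓ 𝒯ᵢ`, where `𝒯ᵢ = {ℓ(x−1)+i : x ∈ β_{s_{i−1}}(λⁱ)}`
(with `i : Fin ℓ` corresponding to the row index `i+1`). -/
def tauSetQ (ℓ : ℕ) (s : Fin ℓ → ℚ) (lam : Fin ℓ → List ℕ) : Set ℚ :=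
  ⋃ i : Fin ℓ,
    (fun x : ℚ => (ℓ : ℚ) * (x - 1) + ((i : ℕ) + 1 : ℚ)) ''
      Set.range (betaSetQ (lam i) (s i))

/-- The set `𝒯` is invariant under the action of permutations on charges and multipartitions. -/
theorem tauSetQ_perm {ℓ : ℕ} (hℓ : (ℓ : ℚ) ≠ 0) (s : Fin ℓ → ℚ) (lam : Fin ℓ → List ℕ)
    (w : Equiv.Perm (Fin ℓ)) :
    tauSetQ ℓ (fun i => s (w i) + (((w i : Fin ℓ) : ℕ) - ((i : ℕ) : ℚ)) / (ℓ : ℚ))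
      (fun i => lam (w i)) = tauSetQ ℓ s lam := by
  unfold tauSetQ
  refine (Set.iUnion_congr fun i => ?_).trans (w.surjective.iUnion_comp _)
  rw [← Set.range_comp, ← Set.range_comp]
  congr 1
  funext j
  simp only [Function.comp_apply, betaSetQ]
  field_simp
  ring

/-- For a permutation `w` of `{1,…,ℓ}`, with `w·λ = (λ^{w⁻¹(1)},…,λ^{w⁻¹(ℓ)})` and
`(w·s)_{i−1} = s_{w⁻¹(i)−1} + (w⁻¹(i) − i)/ℓ`, the tuple `w·s` again has sum `0`
and `ℓ·(w·s)ᵢ ∈ ℤ`, and `τ_{w·s}(w·λ) = τ_s(λ)` (the partition `τ` being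
characterized by the property that its β-set `β₀` has range the set `𝒯`). -/
theorem statement13 (ℓ n : ℕ) (hℓ : 1 ≤ ℓ) (s : Fin ℓ → ℚ)
    (hsum : ∑ i, s i = 0) (hint : ∀ i, ∃ k : ℤ, (ℓ : ℚ) * s i = (k : ℚ))
    (lam : Fin ℓ → List ℕ) (hlam : ∀ i, IsPartitionList (lam i))
    (hn : ∑ i, (lam i).sum = n)
    (w : Equiv.Perm (Fin ℓ)) :
    (∑ i, (s (w⁻¹ i) + (((w⁻¹ i : Fin ℓ) : ℕ) - ((i : ℕ) : ℚ)) / (ℓ : ℚ)) = 0) ∧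
    (∀ i : Fin ℓ, ∃ k : ℤ,
      (ℓ : ℚ) * (s (w⁻¹ i) + (((w⁻¹ i : Fin ℓ) : ℕ) - ((i : ℕ) : ℚ)) / (ℓ : ℚ)) = (k : ℚ)) ∧
    (∀ ρ : List ℕ, IsPartitionList ρ →
      (Set.range (betaSetQ ρ 0) = tauSetQ ℓ s lam ↔
        Set.range (betaSetQ ρ 0) =
          tauSetQ ℓ
            (fun i => s (w⁻¹ i) + (((w⁻¹ i : Fin ℓ) : ℕ) - ((i : ℕ) : ℚ)) / (ℓ : ℚ))
            (fun i => lam (w⁻¹ i)))) := by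
  have hℓ' : (ℓ : ℚ) ≠ 0 := by exact_mod_cast (by omega : ℓ ≠ 0)
  refine ⟨?_, fun i => ?_, fun ρ _ => by rw [tauSetQ_perm hℓ']⟩
  · rw [Finset.sum_add_distrib, ← Finset.sum_div, Finset.sum_sub_distrib,
      Equiv.sum_comp w⁻¹ s, Equiv.sum_comp w⁻¹ (fun i : Fin ℓ => ((i : ℕ) : ℚ)), hsum]
    simp
  · obtain ⟨k, hk⟩ := hint (w⁻¹ i)
    refine ⟨k + (((w⁻¹ i : Fin ℓ) : ℕ) - ((i : ℕ) : ℤ)), ?_⟩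
    rw [mul_add, hk, mul_div_cancel₀ _ hℓ']
    push_cast
    rfl
end

section
/- Let ℓ ≥ 1, let s = (s₀,…,s_{ℓ−1}) be an ℓ-tuple of rationals with Σᵢ sᵢ = 0 and ℓsᵢ ∈ ℤ for all i, and let λ = (λ¹,…,λ^ℓ) be an ℓ-multipartition of n. Set s̄ = (−s_{ℓ−1}, −s_{ℓ−2}, …, −s₀) and λ̄ = (ᵗλ^ℓ, ᵗλ^{ℓ−1}, …, ᵗλ¹), where ᵗρ denotes the conjugate (transposed) partition of ρ. Then τ_{s̄}(λ̄) = ᵗ(τ_s(λ)). -/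
open scoped BigOperators

/-- `σ` is the conjugate (transposed) partition of `ρ` : the Young diagrams are
transposes of each other, i.e. cell `(i, j)` lies in `ρ` iff cell `(j, i)` lies in `σ`. -/
def IsConjPart (ρ σ : List ℕ) : Prop :=
  ∀ i j : ℕ, (j < ρ.getD i 0 ↔ i < σ.getD j 0)

/-- The β-numbers `ρ_j - j` and `1 - (σ_i - i)` of conjugate partitions never coincide. -/
theorem IsConjPart.beta_add_beta_ne_one {ρ σ : List ℕ} (h : IsConjPart ρ σ) (i j : ℕ) :
    ((ρ.getD i 0 : ℤ) - i) + ((σ.getD j 0 : ℤ) - j) ≠ 1 := by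
  have := h i j
  omega

/-- Every integer `x` is a β-number of `ρ`, unless `1 - x` is one of the conjugate partition. -/
theorem IsConjPart.exists_beta_or {ρ σ : List ℕ} (h : IsConjPart ρ σ) (x : ℤ) :
    (∃ j : ℕ, x = (ρ.getD j 0 : ℤ) - j) ∨ ∃ i : ℕ, 1 - x = (σ.getD i 0 : ℤ) - i := by
  have hex : ∃ j : ℕ, (ρ.getD j 0 : ℤ) - j ≤ x := by
    refine ⟨ρ.length + x.natAbs, ?_⟩
    rw [List.getD_eq_default _ _ (by omega)]
    omega
  classical
  have hj := Nat.find_spec hex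
  have hmin : ∀ k < Nat.find hex, ¬ (ρ.getD k 0 : ℤ) - k ≤ x := fun k => Nat.find_min hex
  generalize Nat.find hex = j at hj hmin
  rcases hj.eq_or_lt with heq | hlt
  · exact Or.inl ⟨j, heq.symm⟩
  · right
    obtain ⟨i, hi⟩ : ∃ i : ℕ, (i : ℤ) = x + j - 1 := ⟨(x + j - 1).toNat, by omega⟩
    refine ⟨i, ?_⟩
    have hle := h j i
    rcases j with _ | k
    · omega
    · have hk := hmin k (by omega)
      have hgt := h k i
      omega

/-- If the β-set with charge `0` of a partition is `tauSetQ ℓ s lam`, then the residues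
`ℓ sᵢ + i + 1` modulo `ℓ` exhaust `ZMod ℓ`. -/
theorem residue_surjective_of_range_eq_tauSetQ {ℓ : ℕ} (hℓ : 1 ≤ ℓ) {s : Fin ℓ → ℚ} {c : Fin ℓ → ℤ}
    (hc : ∀ i, (ℓ : ℚ) * s i = c i) {lam : Fin ℓ → List ℕ} {ρ : List ℕ}
    (hτ : Set.range (betaSetQ ρ 0) = tauSetQ ℓ s lam) :
    Function.Surjective fun i : Fin ℓ => ((c i + (i : ℕ) + 1 : ℤ) : ZMod ℓ) := by
  intro r
  have : NeZero ℓ := ⟨by omega⟩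
  have hlen : ρ.length ≤ ℓ * ρ.length + (-r).val := by nlinarith
  have hmem : betaSetQ ρ 0 (ℓ * ρ.length + (-r).val) ∈ tauSetQ ℓ s lam := hτ ▸ ⟨_, rfl⟩
  simp only [tauSetQ, Set.mem_iUnion, Set.mem_image, Set.mem_range, exists_exists_eq_and] at hmem
  obtain ⟨i, k, hk⟩ := hmem
  refine ⟨i, ?_⟩
  simp only [betaSetQ, List.getD_eq_default _ _ hlen] at hk
  have hz : (ℓ : ℤ) * (((lam i).getD k 0 : ℤ) - k - 1) + (c i + (i : ℕ) + 1) =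
      -(ℓ * ρ.length + (-r).val : ℤ) := by
    have := hc i
    qify
    push_cast at hk
    linarith
  have hcast := congrArg (Int.cast : ℤ → ZMod ℓ) hz
  push_cast at hcast
  simpa using hcast

/-- With `s̄ = (−s_{ℓ−1}, …, −s₀)` and `λ̄ = (ᵗλ^ℓ, …, ᵗλ¹)`, one has
`τ_{s̄}(λ̄) = ᵗ(τ_s(λ))` — here `τ` is characterized by the property that its β-set
`β₀` has range the set `𝒯`, `ρ = τ_s(λ)` and `σ = ᵗρ`. -/
theorem statement14 (ℓ n : ℕ) (hℓ : 1 ≤ ℓ) (s : Fin ℓ → ℚ)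
    (hsum : ∑ i, s i = 0) (hint : ∀ i, ∃ k : ℤ, (ℓ : ℚ) * s i = (k : ℚ))
    (lam : Fin ℓ → List ℕ) (hlam : ∀ i, IsPartitionList (lam i))
    (hn : ∑ i, (lam i).sum = n)
    (lambar : Fin ℓ → List ℕ) (hlambar : ∀ i, IsPartitionList (lambar i))
    (hconjbar : ∀ i : Fin ℓ, IsConjPart (lam i.rev) (lambar i))
    (ρ σ : List ℕ) (hρ : IsPartitionList ρ) (hσ : IsPartitionList σ)
    (hτ : Set.range (betaSetQ ρ 0) = tauSetQ ℓ s lam)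
    (hconj : IsConjPart ρ σ) :
    Set.range (betaSetQ σ 0) = tauSetQ ℓ (fun i => - s i.rev) lambar := by
  choose c hc using hint
  have hsurj := residue_surjective_of_range_eq_tauSetQ hℓ hc hτ
  have : NeZero ℓ := ⟨by omega⟩
  have hinj : Function.Injective fun i : Fin ℓ => ((c i + (i : ℕ) + 1 : ℤ) : ZMod ℓ) :=
    ((Fintype.bijective_iff_surjective_and_card _).2 ⟨hsurj, by simp [ZMod.card]⟩).1
  have hrev : ∀ i : Fin ℓ, ((i.rev : ℕ) : ℚ) = ℓ - 1 - (i : ℕ) := by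
    intro i
    rw [Fin.val_rev, Nat.cast_sub (by omega)]
    push_cast
    ring
  ext y
  simp only [tauSetQ, Set.mem_iUnion, Set.mem_image, Set.mem_range, exists_exists_eq_and]
  constructor
  · rintro ⟨j, rfl⟩
    obtain ⟨i, hi⟩ := hsurj ((1 - ((σ.getD j 0 : ℤ) - j) : ℤ) : ZMod ℓ)
    obtain ⟨q, hq⟩ := (ZMod.intCast_eq_intCast_iff_dvd_sub _ _ ℓ).1 hi
    have hcb : IsConjPart (lam i) (lambar i.rev) := by simpa using hconjbar i.rev
    rcases hcb.exists_beta_or (q + 1) with ⟨k, hk⟩ | ⟨k, hk⟩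
    · exfalso
      have hmem : (1 - betaSetQ σ 0 j) ∈ tauSetQ ℓ s lam := by
        simp only [tauSetQ, Set.mem_iUnion, Set.mem_image, Set.mem_range, exists_exists_eq_and]
        refine ⟨i, k, ?_⟩
        have := hc i
        simp only [betaSetQ]
        qify at hk hq
        linear_combination this - hq - (ℓ : ℚ) * hk
      rw [← hτ] at hmem
      obtain ⟨m, hm⟩ := hmem
      apply hconj.beta_add_beta_ne_one m j
      simp only [betaSetQ] at hm
      qify
      linarith
    · refine ⟨i.rev, k, ?_⟩
      have := hc i
      simp only [betaSetQ, hrev, Fin.rev_rev]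
      qify at hk hq
      linear_combination -this + hq - (ℓ : ℚ) * hk
  · rintro ⟨i, k, rfl⟩
    have hci := hc i.rev
    have hri := hrev i
    rcases hconj.exists_beta_or
      (1 - (ℓ * (((lambar i).getD k 0 : ℤ) - k - 1) - c i.rev + (i : ℕ) + 1))
      with ⟨j, hj⟩ | ⟨j, hj⟩
    · exfalso
      have hmem : betaSetQ ρ 0 j ∈ tauSetQ ℓ s lam := hτ ▸ ⟨_, rfl⟩
      simp only [tauSetQ, Set.mem_iUnion, Set.mem_image, Set.mem_range,
        exists_exists_eq_and] at hmem
      obtain ⟨a, m, hm⟩ := hmem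
      have hca := hc a
      simp only [betaSetQ] at hm
      have hz : (ℓ : ℤ) * (((lam a).getD m 0 - m) + ((lambar i).getD k 0 - k) - 1) =
          (c i.rev + (i.rev : ℕ) + 1) - (c a + (a : ℕ) + 1) := by
        qify at hj ⊢
        linear_combination hm - hca - hj - hri
      have ha : a = i.rev :=
        hinj ((ZMod.intCast_eq_intCast_iff_dvd_sub _ _ ℓ).2 ⟨_, hz.symm⟩)
      subst ha
      apply (hconjbar i).beta_add_beta_ne_one m k
      rw [sub_self, mul_eq_zero] at hz
      omega
    · refine ⟨j, ?_⟩
      simp only [betaSetQ]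
      qify at hj
      linear_combination hci - hj
end

section
/- Let ℓ ≥ 1, n ≥ 0, let s = (s₀,…,s_{ℓ−1}) ∈ ℤ^ℓ with Σᵢ sᵢ = 0, and define m = (m⁰,…,m^{ℓ−1}) ∈ ℚ^ℓ by mⁱ = s_{ℓ−1−i} − i/ℓ for 0 ≤ i ≤ ℓ−1. Let λ, μ be ℓ-multipartitions of n and let d be an integer with d ≥ max(hc^λ, hc^μ) + 1. Then τ_s(ᵗλ̄) ⊲ τ_s(ᵗμ̄) if and only if κ^d_m(λ) ⊲ κ^d_m(μ), where λ̄ = (ᵗλ^ℓ, …, ᵗλ¹) (so that ᵗλ̄ = (λ^ℓ, …, λ¹), the reversed multipartition). -/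
open scoped BigOperators

/-- The β-set of a partition `ρ` with charge `s` :
`β_s(ρ)_j = ρ_{j+1} + s − j` (0-indexed). -/
def betaSet (ρ : List ℕ) (s : ℤ) : ℕ → ℤ := fun j => (ρ.getD j 0 : ℤ) + s - j

/-- The set `𝒯 = ⋃_{i=1}^ℓ 𝒯ᵢ`, where `𝒯ᵢ = {ℓ(x−1)+i : x ∈ β_{s_{i−1}}(λⁱ)}`
(with `i : Fin ℓ` corresponding to the row index `i+1`). -/
def tauSet (ℓ : ℕ) (s : Fin ℓ → ℤ) (lam : Fin ℓ → List ℕ) : Set ℤ :=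
  ⋃ i : Fin ℓ,
    (fun x : ℤ => (ℓ : ℤ) * (x - 1) + ((i : ℕ) + 1)) '' Set.range (betaSet (lam i) (s i))

/-- Dominance order for partitions (lists of naturals), via the rational one. -/
def domLTn (a b : List ℕ) : Prop :=
  domLT (a.map (fun x => (x : ℚ))) (b.map (fun x => (x : ℚ)))

theorem IsPartitionList.getD_antitone {l : List ℕ} (hl : IsPartitionList l) :
    Antitone (fun j => l.getD j 0) := by
  intro a b hab
  rcases hab.eq_or_lt with rfl | hab
  · exact le_rfl
  by_cases hb : b < l.length
  · have := List.pairwise_iff_getElem.1 hl.1 a b (hab.trans hb) hb hab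
    simpa [List.getD_eq_getElem, hb, hab.trans hb] using this
  · simp only
    rw [List.getD_eq_default _ _ (not_lt.1 hb)]
    exact Nat.zero_le _

theorem IsPartitionList.getD_pos {l : List ℕ} (hl : IsPartitionList l) {j : ℕ}
    (hj : j < l.length) : 0 < l.getD j 0 := by
  rw [List.getD_eq_getElem _ _ hj]
  exact hl.2 _ (List.getElem_mem hj)

theorem IsPartitionList.ext_getD {a b : List ℕ} (ha : IsPartitionList a)
    (hb : IsPartitionList b) (h : ∀ k, a.getD k 0 = b.getD k 0) : a = b := by
  have hlen : a.length = b.length := by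
    rcases lt_trichotomy a.length b.length with hlt | heq | hlt
    · have := hb.getD_pos hlt
      rw [← h, List.getD_eq_default _ _ le_rfl] at this
      omega
    · exact heq
    · have := ha.getD_pos hlt
      rw [h, List.getD_eq_default _ _ le_rfl] at this
      omega
  refine List.ext_getElem hlen fun k h1 h2 => ?_
  have := h k
  rwa [List.getD_eq_getElem _ _ h1, List.getD_eq_getElem _ _ h2] at this

theorem betaSet_strictAnti {l : List ℕ} (hl : IsPartitionList l) (s : ℤ) :
    StrictAnti (betaSet l s) := by
  intro a b hab
  have : l.getD b 0 ≤ l.getD a 0 := hl.getD_antitone hab.le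
  simp only [betaSet]
  omega

section Row

variable {d : ℤ} {m : ℚ} {l : List ℕ}

theorem symbolRow_eq_append (h : (l.length : ℚ) - m + 1 ≤ d) :
    symbolRow d m l =
      ((List.range (Int.toNat ⌊(d : ℚ) - l.length + m⌋)).map
        (fun j : ℕ => (d : ℚ) - l.length + m - (⌊(d : ℚ) - l.length + m⌋ : ℚ) + (j : ℚ))) ++
      (betaRow l).map (· + ((d : ℚ) - l.length + m)) := by
  rw [symbolRow, shiftRow, if_neg (by linarith)]
  simp [← List.map_eq_flatMap]

theorem length_symbolRow (h : (l.length : ℚ) - m + 1 ≤ d) :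
    (symbolRow d m l).length = (d + ⌊m⌋).toNat := by
  have h1 : ⌊(d : ℚ) - l.length + m⌋ = d - l.length + ⌊m⌋ := by
    rw [← Int.floor_intCast_add]
    push_cast
    rfl
  have h0 : (1 : ℤ) ≤ ⌊(d : ℚ) - l.length + m⌋ := by
    rw [Int.le_floor]
    push_cast
    linarith
  rw [symbolRow_eq_append h, h1]
  rw [h1] at h0
  simp only [betaRow, List.length_append, List.length_map, List.length_range]
  omega

theorem nodup_symbolRow (hl : IsPartitionList l) (h : (l.length : ℚ) - m + 1 ≤ d) :
    (symbolRow d m l).Nodup := by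
  rw [symbolRow_eq_append h, betaRow, List.map_map]
  generalize (d : ℚ) - l.length + m = t
  refine List.Nodup.append ?_ ?_ ?_
  · refine List.nodup_range.map fun a b hab => ?_
    simpa using hab
  · refine (List.nodup_range).map_on fun a ha b hb hab => ?_
    simp only [Function.comp, List.mem_range] at ha hb hab
    have hab' : l.getD (l.length - 1 - a) 0 + a = l.getD (l.length - 1 - b) 0 + b := by
      have := add_right_cancel hab
      exact_mod_cast this
    rcases le_total a b with hle | hle
    · have := hl.getD_antitone (show l.length - 1 - b ≤ l.length - 1 - a by omega)
      simp only at this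
      omega
    · have := hl.getD_antitone (show l.length - 1 - a ≤ l.length - 1 - b by omega)
      simp only at this
      omega
  · intro x hx hx'
    simp only [List.mem_map, List.mem_range, Function.comp] at hx hx'
    obtain ⟨j, hj, rfl⟩ := hx
    obtain ⟨k, -, hk⟩ := hx'
    have hj' : (j : ℚ) < ⌊t⌋ := by
      have : (j : ℤ) < ⌊t⌋ := by omega
      exact_mod_cast this
    have h1 : (0 : ℚ) ≤ (l.getD (l.length - 1 - k) 0 : ℚ) + k := by positivity
    linarith

theorem mem_symbolRow (h : (l.length : ℚ) - m + 1 ≤ d) (y : ℚ) :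
    y ∈ symbolRow d m l ↔ 0 ≤ y ∧ ∃ j : ℕ, y = (l.getD j 0 : ℚ) - j + d - 1 + m := by
  rw [symbolRow_eq_append h, betaRow, List.map_map]
  obtain ⟨t, ht⟩ : ∃ t, t = (d : ℚ) - l.length + m := ⟨_, rfl⟩
  rw [← ht]
  have ht1 : 1 ≤ t := by linarith
  have hf0 : (0 : ℤ) ≤ ⌊t⌋ := Int.floor_nonneg.2 (by linarith)
  have hf1 := Int.floor_le t
  have hf2 := Int.lt_floor_add_one t
  simp only [List.mem_append, List.mem_map, List.mem_range, Function.comp]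
  constructor
  · rintro (⟨j, hj, rfl⟩ | ⟨k, hk, rfl⟩)
    · refine ⟨by have : (0 : ℚ) ≤ j := by positivity
                 linarith, l.length + (⌊t⌋.toNat - 1 - j), ?_⟩
      rw [List.getD_eq_default _ _ (by omega)]
      have : ((⌊t⌋.toNat - 1 - j : ℕ) : ℤ) = ⌊t⌋ - 1 - j := by omega
      have : ((⌊t⌋.toNat - 1 - j : ℕ) : ℚ) = ⌊t⌋ - 1 - j := by exact_mod_cast this
      push_cast [this]
      linarith
    · refine ⟨by positivity, l.length - 1 - k, ?_⟩
      have : ((l.length - 1 - k : ℕ) : ℤ) = l.length - 1 - k := by omega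
      have : ((l.length - 1 - k : ℕ) : ℚ) = l.length - 1 - k := by exact_mod_cast this
      rw [this]
      linarith
  · rintro ⟨hy, j, hj⟩
    by_cases hjl : j < l.length
    · right
      refine ⟨l.length - 1 - j, by omega, ?_⟩
      have : ((l.length - 1 - j : ℕ) : ℤ) = l.length - 1 - j := by omega
      have : ((l.length - 1 - j : ℕ) : ℚ) = l.length - 1 - j := by exact_mod_cast this
      rw [this, show l.length - 1 - (l.length - 1 - j) = j by omega]
      linarith
    · left
      rw [List.getD_eq_default _ _ (by omega)] at hj
      push_cast at hj
      have hlt : (j : ℤ) < l.length + ⌊t⌋ := by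
        have : (j : ℚ) < l.length + ⌊t⌋ := by linarith
        exact_mod_cast this
      refine ⟨l.length + ⌊t⌋.toNat - 1 - j, by omega, ?_⟩
      have : ((l.length + ⌊t⌋.toNat - 1 - j : ℕ) : ℤ) = l.length + ⌊t⌋ - 1 - j := by omega
      have : ((l.length + ⌊t⌋.toNat - 1 - j : ℕ) : ℚ) = l.length + ⌊t⌋ - 1 - j := by
        exact_mod_cast this
      rw [this]
      linarith

end Row

section Symbol

variable {ℓ : ℕ} {s : Fin ℓ → ℤ} {m : Fin ℓ → ℚ} {d : ℤ} {lam : Fin ℓ → List ℕ}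

theorem mem_tauSet_rev {z : ℤ} :
    z ∈ tauSet ℓ s (fun i => lam i.rev) ↔
      ∃ (i : Fin ℓ) (j : ℕ), z = ℓ * betaSet (lam i) (s i.rev) j - (i : ℕ) := by
  have key : ∀ (i : Fin ℓ) (x : ℤ),
      (ℓ : ℤ) * (x - 1) + ((i.rev : ℕ) + 1) = ℓ * x - (i : ℕ) := by
    intro i x
    have : ((i.rev : ℕ) : ℤ) = ℓ - 1 - i := by
      rw [Fin.val_rev]
      omega
    rw [this]
    ring
  simp only [tauSet, Set.mem_iUnion, Set.mem_image, Set.mem_range]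
  constructor
  · rintro ⟨i, _, ⟨j, rfl⟩, rfl⟩
    refine ⟨i.rev, j, ?_⟩
    rw [← key, Fin.rev_rev]
  · rintro ⟨i, j, rfl⟩
    refine ⟨i.rev, _, ⟨j, rfl⟩, ?_⟩
    rw [key, Fin.rev_rev]

theorem symbol_entry (hℓ : 1 ≤ ℓ)
    (hm : ∀ i : Fin ℓ, m i = (s i.rev : ℚ) - ((i : ℕ) : ℚ) / (ℓ : ℚ)) (i : Fin ℓ) (j : ℕ) :
    ((lam i).getD j 0 : ℚ) - j + d - 1 + m i =
      (((ℓ * betaSet (lam i) (s i.rev) j - (i : ℕ) + ℓ * (d - 1) : ℤ)) : ℚ) / ℓ := by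
  have : (ℓ : ℚ) ≠ 0 := by positivity
  rw [hm]
  simp only [betaSet]
  push_cast
  field_simp
  ring

theorem mem_flatMap_symbolRow (hℓ : 1 ≤ ℓ)
    (hm : ∀ i : Fin ℓ, m i = (s i.rev : ℚ) - ((i : ℕ) : ℚ) / (ℓ : ℚ))
    (hd : ∀ i, ((lam i).length : ℚ) - m i + 1 ≤ (d : ℚ)) (y : ℚ) :
    y ∈ (List.finRange ℓ).flatMap (fun i => symbolRow d (m i) (lam i)) ↔
      ∃ z ∈ tauSet ℓ s (fun i => lam i.rev), 0 ≤ z + ℓ * (d - 1) ∧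
        y = ((z + ℓ * (d - 1) : ℤ) : ℚ) / ℓ := by
  have hpos : (0 : ℚ) < ℓ := by positivity
  simp only [List.mem_flatMap, List.mem_finRange, true_and, mem_tauSet_rev]
  constructor
  · rintro ⟨i, hi⟩
    obtain ⟨hy, j, rfl⟩ := (mem_symbolRow (hd i) y).1 hi
    rw [symbol_entry hℓ hm] at hy ⊢
    refine ⟨_, ⟨i, j, rfl⟩, ?_, rfl⟩
    rw [le_div_iff₀ hpos, zero_mul] at hy
    exact_mod_cast hy
  · rintro ⟨z, ⟨i, j, rfl⟩, hz, rfl⟩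
    refine ⟨i, (mem_symbolRow (hd i) _).2 ⟨?_, j, (symbol_entry hℓ hm i j).symm⟩⟩
    have : (0 : ℚ) ≤ ((ℓ * betaSet (lam i) (s i.rev) j - (i : ℕ) + ℓ * (d - 1) : ℤ) : ℚ) := by
      exact_mod_cast hz
    positivity

theorem nodup_flatMap_symbolRow (hℓ : 1 ≤ ℓ) (hlam : ∀ i, IsPartitionList (lam i))
    (hm : ∀ i : Fin ℓ, m i = (s i.rev : ℚ) - ((i : ℕ) : ℚ) / (ℓ : ℚ))
    (hd : ∀ i, ((lam i).length : ℚ) - m i + 1 ≤ (d : ℚ)) :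
    ((List.finRange ℓ).flatMap (fun i => symbolRow d (m i) (lam i))).Nodup := by
  have hpos : (ℓ : ℚ) ≠ 0 := by positivity
  rw [List.nodup_flatMap]
  refine ⟨fun i _ => nodup_symbolRow (hlam i) (hd i),
    (List.nodup_finRange ℓ).imp fun {a b} hab y ha hb => hab ?_⟩
  obtain ⟨-, j, hj⟩ := (mem_symbolRow (hd a) y).1 ha
  obtain ⟨-, k, hk⟩ := (mem_symbolRow (hd b) y).1 hb
  rw [symbol_entry hℓ hm] at hj hk
  rw [hj, div_left_inj' hpos] at hk
  norm_cast at hk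
  have hmod : ((a : ℕ) : ℤ) ≡ (b : ℕ) [ZMOD ℓ] := by
    refine Int.modEq_iff_dvd.2
      ⟨betaSet (lam b) (s b.rev) k - betaSet (lam a) (s a.rev) j, ?_⟩
    linarith
  rw [Int.ModEq, Int.emod_eq_of_lt (by omega) (by omega),
    Int.emod_eq_of_lt (by omega) (by omega)] at hmod
  exact Fin.ext (by exact_mod_cast hmod)

theorem mem_tauSet_rev_of_lt (hℓ : 1 ≤ ℓ)
    (hm : ∀ i : Fin ℓ, m i = (s i.rev : ℚ) - ((i : ℕ) : ℚ) / (ℓ : ℚ))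
    (hd : ∀ i, ((lam i).length : ℚ) - m i + 1 ≤ (d : ℚ)) {z : ℤ}
    (hz : z + ℓ * (d - 1) < 0) : z ∈ tauSet ℓ s (fun i => lam i.rev) := by
  have hpos : (0 : ℚ) < ℓ := by positivity
  have hℓ' : (ℓ : ℤ) ≠ 0 := by omega
  have h0 := Int.emod_nonneg (-z) hℓ'
  have h1 := Int.emod_lt_of_pos (-z) (show (0 : ℤ) < ℓ by omega)
  have h2 := Int.mul_ediv_add_emod (-z) ℓ
  obtain ⟨i, hi⟩ : ∃ i : Fin ℓ, ((i : ℕ) : ℤ) = (-z) % ℓ :=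
    ⟨⟨((-z) % ℓ).toNat, by omega⟩, by simp [h0]⟩
  set x : ℤ := -((-z) / ℓ) with hx
  have hzx : z = ℓ * x - (i : ℕ) := by
    rw [hx, hi]
    linarith
  have hlen : ((lam i).length : ℤ) ≤ s i.rev - x := by
    have h3 := hd i
    rw [hm] at h3
    have h4 : ((z + ℓ * (d - 1) : ℤ) : ℚ) / ℓ < 0 := by
      refine div_neg_of_neg_of_pos ?_ hpos
      exact_mod_cast hz
    have h5 : ((z + ℓ * (d - 1) : ℤ) : ℚ) / ℓ = x - (i : ℕ) / ℓ + (d - 1) := by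
      rw [hzx]
      push_cast
      field_simp
    have h6 : ((lam i).length : ℚ) ≤ s i.rev - x := by linarith
    exact_mod_cast h6
  refine mem_tauSet_rev.2 ⟨i, (s i.rev - x).toNat, ?_⟩
  rw [betaSet, List.getD_eq_default _ _ (by omega), hzx,
    show (((s i.rev - x).toNat : ℕ) : ℤ) = s i.rev - x by omega]
  push_cast
  ring

theorem kappa_eq_map_betaSet (hℓ : 1 ≤ ℓ) (hlam : ∀ i, IsPartitionList (lam i))
    (hm : ∀ i : Fin ℓ, m i = (s i.rev : ℚ) - ((i : ℕ) : ℚ) / (ℓ : ℚ))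
    (hd : ∀ i, ((lam i).length : ℚ) - m i + 1 ≤ (d : ℚ))
    {ρ : List ℕ} (hρ : IsPartitionList ρ)
    (hτ : Set.range (betaSet ρ 0) = tauSet ℓ s (fun i => lam i.rev)) :
    let N := ((List.finRange ℓ).map (fun i => (d + ⌊m i⌋).toNat)).sum
    ρ.length ≤ N ∧
      kappa ℓ d m lam =
        (List.range N).map (fun k => ((betaSet ρ 0 k + ℓ * (d - 1) : ℤ) : ℚ) / ℓ) := by
  intro N
  have hpos : (0 : ℚ) < ℓ := by positivity
  have hanti := betaSet_strictAnti hρ 0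
  have hex : ∃ k, betaSet ρ 0 k + ℓ * (d - 1) < 0 := by
    refine ⟨ρ.length + (ℓ * (d - 1)).toNat + 1, ?_⟩
    rw [betaSet, List.getD_eq_default _ _ (by omega)]
    omega
  classical
  obtain ⟨M, hMspec, hMmin⟩ : ∃ M, betaSet ρ 0 M + ℓ * (d - 1) < 0 ∧
      ∀ k < M, 0 ≤ betaSet ρ 0 k + ℓ * (d - 1) :=
    ⟨Nat.find hex, Nat.find_spec hex, fun k hk => not_lt.1 (Nat.find_min hex hk)⟩
  have hlt : ∀ k, k < M ↔ 0 ≤ betaSet ρ 0 k + ℓ * (d - 1) := by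
    refine fun k => ⟨hMmin k, fun hk => ?_⟩
    by_contra! hle
    have := hanti.antitone hle
    linarith
  have hstrict : StrictAnti (fun k => ((betaSet ρ 0 k + ℓ * (d - 1) : ℤ) : ℚ) / ℓ) := by
    intro a b hab
    have h1 : betaSet ρ 0 b + ℓ * (d - 1) < betaSet ρ 0 a + ℓ * (d - 1) := by
      linarith [hanti hab]
    exact div_lt_div_of_pos_right (by exact_mod_cast h1) hpos
  have hperm : ((List.finRange ℓ).flatMap (fun i => symbolRow d (m i) (lam i))).Perm
      ((List.range M).map (fun k => ((betaSet ρ 0 k + ℓ * (d - 1) : ℤ) : ℚ) / ℓ)) := by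
    refine (List.perm_ext_iff_of_nodup (nodup_flatMap_symbolRow hℓ hlam hm hd)
      (List.nodup_range.map hstrict.injective)).2 fun y => ?_
    rw [mem_flatMap_symbolRow hℓ hm hd, ← hτ]
    simp only [Set.exists_range_iff, List.mem_map, List.mem_range]
    refine exists_congr fun k => ?_
    rw [hlt, eq_comm (a := y)]
  have hNM : N = M := by
    have := hperm.length_eq
    rw [List.length_flatMap, List.length_map, List.length_range] at this
    rw [← this]
    exact congrArg List.sum (List.map_congr_left fun i _ => (length_symbolRow (hd i)).symm)
  rw [hNM]
  constructor
  · by_contra! hlen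
    have hL := hρ.getD_pos (show ρ.length - 1 < ρ.length by omega)
    have hneg : betaSet ρ 0 (ρ.length - 1) + ℓ * (d - 1) < 0 := by
      have := (hlt (ρ.length - 1)).not.1 (by omega)
      exact not_le.1 this
    have hb : betaSet ρ 0 (ρ.length - 1) =
        (ρ.getD (ρ.length - 1) 0 : ℤ) - (ρ.length - 1 : ℕ) := by
      simp [betaSet]
    have hmem : (1 - (ρ.length : ℤ)) ∈ Set.range (betaSet ρ 0) := by
      rw [hτ]
      exact mem_tauSet_rev_of_lt hℓ hm hd (by omega)
    obtain ⟨k, hk⟩ := hmem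
    rcases lt_or_ge k ρ.length with hkl | hkl
    · have := hanti.antitone (show k ≤ ρ.length - 1 by omega)
      omega
    · rw [betaSet, List.getD_eq_default _ _ hkl] at hk
      omega
  · refine List.Perm.eq_of_pairwise (le := fun a b : ℚ => b ≤ a)
      (fun a b _ _ h1 h2 => le_antisymm h2 h1) (List.pairwise_insertionSort _ _) ?_
      ((List.perm_insertionSort _ _).trans hperm)
    rw [List.pairwise_map]
    exact List.pairwise_lt_range.imp fun h => (hstrict h).le

end Symbol

theorem getD_map_range {f : ℕ → ℚ} {N k : ℕ} :
    ((List.range N).map f).getD k 0 = if k < N then f k else 0 := by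
  split_ifs with h
  · rw [List.getD_eq_getElem _ _ (by simpa using h)]
    simp
  · rw [List.getD_eq_default _ _ (by simpa using h)]

theorem domLTn_iff {a b : List ℕ} :
    domLTn a b ↔ domLT (a.map (Nat.cast : ℕ → ℚ)) (b.map (Nat.cast : ℕ → ℚ)) := by
  simp [domLTn, ← List.map_eq_flatMap, Function.comp_def]

theorem getD_map_natCast (a : List ℕ) (k : ℕ) :
    (a.map (Nat.cast : ℕ → ℚ)).getD k 0 = (a.getD k 0 : ℚ) := by
  simpa using List.getD_map (l := a) (d := 0) (n := k) (Nat.cast : ℕ → ℚ)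

/-- Truncating the `β`-sequences of two partitions beyond their lengths and rescaling
them affinely does not change the dominance order. -/
theorem domLTn_iff_domLT_map_betaSet {ρ σ : List ℕ} (hρ : IsPartitionList ρ)
    (hσ : IsPartitionList σ) {N : ℕ} (hρN : ρ.length ≤ N) (hσN : σ.length ≤ N) (c : ℤ)
    {q : ℚ} (hq : 0 < q) :
    domLTn ρ σ ↔ domLT ((List.range N).map (fun k => ((betaSet ρ 0 k + c : ℤ) : ℚ) / q))
      ((List.range N).map (fun k => ((betaSet σ 0 k + c : ℤ) : ℚ) / q)) := by
  have hdiff : ∀ k, ((List.range N).map (fun k => ((betaSet σ 0 k + c : ℤ) : ℚ) / q)).getD k 0 -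
      ((List.range N).map (fun k => ((betaSet ρ 0 k + c : ℤ) : ℚ) / q)).getD k 0 =
      ((σ.getD k 0 : ℚ) - ρ.getD k 0) / q := by
    intro k
    rw [getD_map_range, getD_map_range]
    split_ifs with h
    · simp only [betaSet]
      push_cast
      ring
    · rw [List.getD_eq_default _ _ (by omega), List.getD_eq_default _ _ (by omega)]
      simp
  rw [domLTn_iff, domLT, domLT]
  refine and_congr ?_ (not_congr ?_)
  · refine forall_congr' fun i => ?_
    rw [← sub_nonneg, ← Finset.sum_sub_distrib, ← sub_nonneg (b := Finset.sum _ _),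
      ← Finset.sum_sub_distrib, Finset.sum_congr rfl fun k _ => hdiff k, ← Finset.sum_div,
      le_div_iff₀ hq, zero_mul]
    simp only [getD_map_natCast]
  · constructor
    · intro h
      rw [List.map_injective_iff.2 Nat.cast_injective h]
    · intro h
      have : ρ = σ := hρ.ext_getD hσ fun k => by
        have hk := hdiff k
        rw [h, sub_self, eq_comm, div_eq_zero_iff, or_iff_left hq.ne', sub_eq_zero] at hk
        exact_mod_cast hk.symm
      rw [this]

/-- For `s ∈ ℤ₀^ℓ` and `mⁱ = s_{ℓ−1−i} − i/ℓ` :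
`τ_s(ᵗλ̄) ⊲ τ_s(ᵗμ̄) ⟺ κ^d_m(λ) ⊲ κ^d_m(μ)`, where `ᵗλ̄ = (λ^ℓ, …, λ¹)` is the
reversed multipartition and `τ` is characterized by the property that its β-set
`β₀` has range the set `𝒯`. -/
theorem statement16 (ℓ n : ℕ) (hℓ : 1 ≤ ℓ) (s : Fin ℓ → ℤ) (hsum : ∑ i, s i = 0)
    (lam mu : Fin ℓ → List ℕ)
    (hlam : ∀ i, IsPartitionList (lam i)) (hmu : ∀ i, IsPartitionList (mu i))
    (hlamn : ∑ i, (lam i).sum = n) (hmun : ∑ i, (mu i).sum = n)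
    (m : Fin ℓ → ℚ) (hm : ∀ i : Fin ℓ, m i = (s i.rev : ℚ) - ((i : ℕ) : ℚ) / (ℓ : ℚ))
    (d : ℤ)
    (hdlam : ∀ i, ((lam i).length : ℚ) - m i + 1 ≤ (d : ℚ))
    (hdmu : ∀ i, ((mu i).length : ℚ) - m i + 1 ≤ (d : ℚ))
    (ρ σ : List ℕ) (hρ : IsPartitionList ρ) (hσ : IsPartitionList σ)
    (hτρ : Set.range (betaSet ρ 0) = tauSet ℓ s (fun i => lam i.rev))
    (hτσ : Set.range (betaSet σ 0) = tauSet ℓ s (fun i => mu i.rev)) :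
    domLTn ρ σ ↔ domLT (kappa ℓ d m lam) (kappa ℓ d m mu) := by
  obtain ⟨hρN, hκρ⟩ := kappa_eq_map_betaSet hℓ hlam hm hdlam hρ hτρ
  obtain ⟨hσN, hκσ⟩ := kappa_eq_map_betaSet hℓ hmu hm hdmu hσ hτσ
  rw [hκρ, hκσ]
  exact domLTn_iff_domLT_map_betaSet hρ hσ hρN hσN _ (by positivity)
end

section
/- Let n ≥ 1, let b be a nonnegative integer, set m = (b, 0) ∈ ℚ², and let d be an integer with d ≥ n + 1. Let λ and μ be 2-multipartitions of n, and write the first row of B^d_m(λ) as x₁ < x₂ < … < x_{d+b} and the second row as y₁ < y₂ < … < y_d. Suppose B^d_m(μ) is obtained from B^d_m(λ) by exchanging a single entry xᵢ of the first row with a single entry y_j of the second row, where xᵢ < y_j (so the first row of B^d_m(μ) consists of the x's with xᵢ replaced by y_j, and the second row of the y's with y_j replaced by xᵢ, each rewritten in increasing order). Then κ^d_{m+½}(λ) ⊲ κ^d_{m+½}(μ) and κ^d_{m−½}(μ) ⊲ κ^d_{m−½}(λ), where m ± ½ = (b ± ½, 0). -/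
open scoped BigOperators

/-- The sum of the positive parts of the entries of `s` measured from the level `c`. -/
def excess (c : ℚ) (s : Multiset ℚ) : ℚ := (s.map fun v => max (v - c) 0).sum

theorem excess_cons (c v : ℚ) (s : Multiset ℚ) :
    excess c (v ::ₘ s) = max (v - c) 0 + excess c s := by
  simp [excess]

theorem excess_add (c : ℚ) (s t : Multiset ℚ) : excess c (s + t) = excess c s + excess c t := by
  simp [excess]

theorem excess_nonneg (c : ℚ) (s : Multiset ℚ) : 0 ≤ excess c s := by
  induction s using Multiset.induction_on with
  | empty => simp [excess]
  | cons v s ih => rw [excess_cons]; positivity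

theorem excess_map_mono (c : ℚ) (f g : ℚ → ℚ) (s : Multiset ℚ) (h : ∀ v, f v ≤ g v) :
    excess c (s.map f) ≤ excess c (s.map g) := by
  induction s using Multiset.induction_on with
  | empty => simp
  | cons v s ih =>
    simp only [Multiset.map_cons, excess_cons]
    gcongr
    exact h v

theorem sum_range_getD_eq_sum_take (a : List ℚ) (i : ℕ) :
    ∑ k ∈ Finset.range i, a.getD k 0 = (a.take i).sum := by
  induction a generalizing i with
  | nil => simp
  | cons v a ih =>
    cases i with
    | zero => simp
    | succ i => simp [Finset.sum_range_succ', ← ih, add_comm]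

theorem sum_le_length_mul_add_excess (c : ℚ) (l : List ℚ) :
    l.sum ≤ l.length * c + excess c l := by
  induction l with
  | nil => simp [excess]
  | cons v l ih =>
    rw [← Multiset.cons_coe, excess_cons]
    push_cast [List.sum_cons, List.length_cons]
    linarith [le_max_left (v - c) 0]

theorem sum_eq_length_mul_add_excess (c : ℚ) (l : List ℚ) (h : ∀ v ∈ l, c ≤ v) :
    l.sum = l.length * c + excess c l := by
  induction l with
  | nil => simp [excess]
  | cons v l ih =>
    rw [← Multiset.cons_coe, excess_cons, max_eq_left (by linarith [h v (by simp)])]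
    push_cast [List.sum_cons, List.length_cons]
    linarith [ih fun w hw => h w (by simp [hw])]

theorem excess_eq_zero (c : ℚ) (s : Multiset ℚ) (h : ∀ v ∈ s, v ≤ c) : excess c s = 0 := by
  induction s using Multiset.induction_on with
  | empty => simp [excess]
  | cons v s ih =>
    rw [excess_cons, max_eq_right (by linarith [h v (by simp)]),
      ih fun w hw => h w (by simp [hw]), add_zero]

theorem exists_forall_mem_ge (l : List ℚ) : ∃ c, ∀ v ∈ l, c ≤ v := by
  induction l with
  | nil => simp
  | cons w l ih =>
    obtain ⟨c, hc⟩ := ih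
    refine ⟨min w c, fun v hv => ?_⟩
    rcases List.mem_cons.1 hv with rfl | hv
    · exact min_le_left _ _
    · exact (min_le_right _ _).trans (hc v hv)

theorem exists_level (b : List ℚ) (hb : b.Pairwise fun u v => v ≤ u) (i : ℕ) :
    ∃ c, (∀ v ∈ b.take i, c ≤ v) ∧ ∀ v ∈ b.drop i, v ≤ c := by
  rw [← List.take_append_drop i b, List.pairwise_append] at hb
  obtain ⟨-, hd, htd⟩ := hb
  rcases hcase : b.drop i with _ | ⟨w, ws⟩
  · obtain ⟨c, hc⟩ := exists_forall_mem_ge (b.take i)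
    exact ⟨c, hc, by simp⟩
  · rw [hcase] at hd htd
    refine ⟨w, fun v hv => htd v hv w (by simp), fun v hv => ?_⟩
    rcases List.mem_cons.1 hv with rfl | hv
    · exact le_rfl
    · exact (List.pairwise_cons.1 hd).1 v hv

theorem domLE_of_excess_le (a b : List ℚ) (hlen : a.length = b.length)
    (hb : b.Pairwise fun u v => v ≤ u) (h : ∀ c, excess c a ≤ excess c b) : domLE a b := by
  intro i
  rw [sum_range_getD_eq_sum_take, sum_range_getD_eq_sum_take]
  obtain ⟨c, hct, hcd⟩ := exists_level b hb i
  have split (l : List ℚ) : excess c l = excess c (l.take i) + excess c (l.drop i) := by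
    rw [← excess_add, Multiset.coe_add, List.take_append_drop]
  have ha := sum_le_length_mul_add_excess c (a.take i)
  have hb' := sum_eq_length_mul_add_excess c (b.take i) hct
  have hl : (a.take i).length = (b.take i).length := by simp [hlen]
  rw [hl] at ha
  have h0 : excess c (b.drop i) = 0 := excess_eq_zero c _ (by simpa using hcd)
  have := h c
  rw [split a, split b] at this
  linarith [excess_nonneg c (a.drop i)]

theorem pairwise_kappa (ℓ : ℕ) (d : ℤ) (m : Fin ℓ → ℚ) (lam : Fin ℓ → List ℕ) :
    (kappa ℓ d m lam).Pairwise fun u v => v ≤ u :=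
  have : Std.Total (fun a b : ℚ => b ≤ a) := ⟨fun a b => le_total b a⟩
  have : IsTrans ℚ (fun a b : ℚ => b ≤ a) := ⟨fun _ _ _ h h' => h'.trans h⟩
  List.pairwise_insertionSort _ _

theorem coe_kappa_two (d : ℤ) (m₀ m₁ : ℚ) (lam : Fin 2 → List ℕ) :
    (kappa 2 d ![m₀, m₁] lam : Multiset ℚ) =
      (symbolRow d m₀ (lam 0) : Multiset ℚ) + (symbolRow d m₁ (lam 1) : Multiset ℚ) := by
  rw [kappa, Multiset.coe_eq_coe.2 (List.perm_insertionSort _ _)]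
  simp [List.finRange_succ]

theorem domLT_kappa_of_excess (d : ℤ) (m : Fin 2 → ℚ) (lam mu : Fin 2 → List ℕ)
    (s t : Multiset ℚ) (hs : (kappa 2 d m lam : Multiset ℚ) = s)
    (ht : (kappa 2 d m mu : Multiset ℚ) = t) (hcard : s.card = t.card)
    (hle : ∀ c, excess c s ≤ excess c t) (hlt : ∃ c, excess c s < excess c t) :
    domLT (kappa 2 d m lam) (kappa 2 d m mu) := by
  subst hs ht
  refine ⟨domLE_of_excess_le _ _ (by simpa using hcard) (pairwise_kappa _ _ _ _) hle, ?_⟩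
  intro heq
  obtain ⟨c, hc⟩ := hlt
  rw [heq] at hc
  exact hc.false

/-- Moving a pair of entries apart, keeping its sum, increases the excess at every level. -/
theorem max_add_max_le {p q p' q' : ℚ} (hsum : p + q = p' + q') (hp : p' ≤ p) (hq : p ≤ q') (c : ℚ) :
    max (p - c) 0 + max (q - c) 0 ≤ max (p' - c) 0 + max (q' - c) 0 := by
  rcases max_cases (p - c) 0 with h1 | h1 <;> rcases max_cases (q - c) 0 with h2 | h2 <;>
  rcases max_cases (p' - c) 0 with h3 | h3 <;> rcases max_cases (q' - c) 0 with h4 | h4 <;>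
  linarith

/-- The entries of the row `β(t + 1)`, for a natural number `t`, apart from the leading `0`. -/
def shiftRowTail (β : List ℚ) (t : ℕ) : List ℚ :=
  (List.range t).map (fun j => ((j + 1 : ℕ) : ℚ)) ++ β.map (· + (t + 1 : ℚ))

theorem shiftRow_eq_of_floor_eq (β : List ℚ) (t : ℚ) (k : ℕ) (hk : ⌊t⌋ = k) (hk0 : 0 < k) :
    shiftRow β t = (List.range k).map (fun j : ℕ => t - k + (j : ℚ)) ++ β.map (· + t) := by
  have h1 : (1 : ℚ) ≤ k := by exact_mod_cast hk0
  have h2 : (k : ℚ) ≤ t := by simpa [hk] using Int.floor_le t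
  rw [shiftRow, if_neg (by linarith), hk, Int.toNat_natCast]
  simp [← List.map_eq_flatMap]

theorem shiftRow_natCast_succ (β : List ℚ) (t : ℕ) :
    shiftRow β (t + 1) = 0 :: shiftRowTail β t := by
  rw [shiftRow_eq_of_floor_eq β _ (t + 1) (by exact_mod_cast Int.floor_natCast (R := ℚ) (t + 1))
    t.succ_pos, List.range_succ_eq_map]
  simp [shiftRowTail, Function.comp_def]

theorem shiftRow_natCast_succ_add_half (β : List ℚ) (t : ℕ) :
    shiftRow β (t + 1 + 1 / 2) = (0 :: shiftRowTail β t).map (· + 1 / 2) := by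
  have hf : ⌊(t + 1 + 1 / 2 : ℚ)⌋ = ((t + 1 : ℕ) : ℤ) := by
    rw [Int.floor_eq_iff]; push_cast; constructor <;> linarith
  rw [shiftRow_eq_of_floor_eq β _ (t + 1) hf t.succ_pos, List.range_succ_eq_map]
  simp only [shiftRowTail, List.map_cons, List.map_append, List.map_map, Function.comp_def,
    List.cons_append]
  push_cast
  refine congrArg₂ _ (by ring) ?_
  congr 2
  · funext j; ring
  · funext v; ring

theorem shiftRow_natCast_succ_sub_half (β : List ℚ) (t : ℕ) (ht : 0 < t) :
    shiftRow β (t + 1 - 1 / 2) = (shiftRowTail β t).map (· - 1 / 2) := by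
  have hf : ⌊(t + 1 - 1 / 2 : ℚ)⌋ = (t : ℤ) := by
    rw [Int.floor_eq_iff]; push_cast; constructor <;> linarith
  rw [shiftRow_eq_of_floor_eq β _ t hf ht]
  simp only [shiftRowTail, List.map_append, List.map_map, Function.comp_def]
  push_cast
  congr 2
  · funext j; ring
  · funext v; ring

theorem length_shiftRow_sub_half (β : List ℚ) (t : ℕ) :
    (shiftRow β (t + 1 - 1 / 2)).length = (shiftRowTail β t).length := by
  rcases Nat.eq_zero_or_pos t with rfl | ht
  · norm_num [shiftRow, shiftRowTail]
  · rw [shiftRow_natCast_succ_sub_half β t ht, List.length_map]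

theorem excess_shiftRow_sub_half_le (c : ℚ) (β : List ℚ) (t : ℕ) :
    excess c (shiftRow β (t + 1 - 1 / 2)) ≤ excess c ((shiftRowTail β t).map (· - 1 / 2)) := by
  rcases Nat.eq_zero_or_pos t with rfl | ht
  · have := excess_map_mono c id (fun v => v + 1 - 1 / 2) β (fun v => by simp only [id]; linarith)
    norm_num [shiftRow, shiftRowTail, Function.comp_def] at this ⊢
    exact this
  · rw [shiftRow_natCast_succ_sub_half β t ht]

theorem pairwise_betaRow (l : List ℕ) (hl : l.Pairwise (· ≥ ·)) :
    (betaRow l).Pairwise (· < ·) := by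
  rw [betaRow, List.pairwise_map]
  refine List.pairwise_lt_range.imp_of_mem ?_
  intro i j hi hj hij
  rw [List.mem_range] at hi hj
  have : l.getD (l.length - 1 - i) 0 ≤ l.getD (l.length - 1 - j) 0 := by
    rw [List.getD_eq_getElem _ _ (by omega), List.getD_eq_getElem _ _ (by omega)]
    exact List.pairwise_iff_getElem.1 hl _ _ _ _ (by omega)
  have h1 : (l.getD (l.length - 1 - i) 0 : ℚ) ≤ l.getD (l.length - 1 - j) 0 := by exact_mod_cast this
  have h2 : (i : ℚ) < j := by exact_mod_cast hij
  linarith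

theorem nonneg_of_mem_betaRow {l : List ℕ} {v : ℚ} (hv : v ∈ betaRow l) : 0 ≤ v := by
  obtain ⟨k, -, rfl⟩ := List.mem_map.1 hv
  positivity

theorem exists_natCast_of_mem_betaRow {l : List ℕ} {v : ℚ} (hv : v ∈ betaRow l) :
    ∃ k : ℕ, v = k := by
  obtain ⟨k, -, rfl⟩ := List.mem_map.1 hv
  exact ⟨l.getD (l.length - 1 - k) 0 + k, by push_cast; rfl⟩

theorem exists_natCast_of_mem_shiftRowTail {l : List ℕ} {t : ℕ} {v : ℚ}
    (hv : v ∈ shiftRowTail (betaRow l) t) : ∃ k : ℕ, v = ((k + 1 : ℕ) : ℚ) := by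
  rw [shiftRowTail, List.mem_append, List.mem_map, List.mem_map] at hv
  rcases hv with ⟨j, -, rfl⟩ | ⟨w, hw, rfl⟩
  · exact ⟨j, rfl⟩
  · obtain ⟨k, rfl⟩ := exists_natCast_of_mem_betaRow hw
    exact ⟨k + t, by push_cast; ring⟩

theorem nodup_shiftRowTail (l : List ℕ) (hl : l.Pairwise (· ≥ ·)) (t : ℕ) :
    (shiftRowTail (betaRow l) t).Nodup := by
  rw [shiftRowTail, List.nodup_append]
  refine ⟨List.nodup_range.map fun i j h => ?_,
    List.Nodup.map (add_left_injective _) ((pairwise_betaRow l hl).imp fun h => h.ne), ?_⟩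
  · simpa using h
  · intro u hu v hv
    obtain ⟨j, hj, rfl⟩ := List.mem_map.1 hu
    obtain ⟨w, hw, rfl⟩ := List.mem_map.1 hv
    have h0 := nonneg_of_mem_betaRow hw
    have : (j : ℚ) < t := by exact_mod_cast List.mem_range.1 hj
    push_cast
    intro h
    linarith

theorem nodup_cons_shiftRowTail (l : List ℕ) (hl : l.Pairwise (· ≥ ·)) (t : ℕ) :
    (0 :: shiftRowTail (betaRow l) t).Nodup := by
  refine List.nodup_cons.2 ⟨fun h => ?_, nodup_shiftRowTail l hl t⟩
  obtain ⟨k, hk⟩ := exists_natCast_of_mem_shiftRowTail h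
  have : (0 : ℚ) ≠ ((k + 1 : ℕ) : ℚ) := by positivity
  exact this hk

theorem IsPartitionList.length_le_sum {l : List ℕ} (hl : IsPartitionList l) :
    l.length ≤ l.sum := by
  simpa using List.card_nsmul_le_sum l 1 fun v hv => hl.2 v hv

theorem IsPartitionList.eq_nil_of_sum_eq_zero {l : List ℕ} (hl : IsPartitionList l)
    (h : l.sum = 0) : l = [] :=
  List.length_eq_zero_iff.1 (by have := hl.length_le_sum; omega)

/-- The row with parameter `m + ε` in terms of the integral shift `t + 1` at parameter `m`. -/
theorem symbolRow_eq (d : ℤ) (m t : ℕ) (ε : ℚ) (l : List ℕ)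
    (ht : (t : ℤ) + 1 = d - l.length + m) :
    symbolRow d (m + ε) l = shiftRow (betaRow l) (t + 1 + ε) := by
  have : (t : ℚ) + 1 = d - l.length + m := by exact_mod_cast ht
  rw [symbolRow, this]
  ring_nf

/-- Single-transposition lemma : if the symbol of `μ` (at `m = (b, 0)`, size `d ≥ n+1`)
is obtained from the symbol of `λ` by exchanging an entry `x` of the first row with an
entry `y` of the second row, where `x < y`, then
`κ^d_{m+½}(λ) ⊲ κ^d_{m+½}(μ)` and `κ^d_{m−½}(μ) ⊲ κ^d_{m−½}(λ)`. -/
theorem statement18 (n : ℕ) (hn : 1 ≤ n) (b : ℕ) (d : ℤ) (hd : (n : ℤ) + 1 ≤ d)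
    (lam mu : Fin 2 → List ℕ)
    (hlam : ∀ i, IsPartitionList (lam i)) (hmu : ∀ i, IsPartitionList (mu i))
    (hlamn : ∑ i, (lam i).sum = n) (hmun : ∑ i, (mu i).sum = n)
    (x y : ℚ)
    (hx : x ∈ symbolRow d (b : ℚ) (lam 0)) (hy : y ∈ symbolRow d 0 (lam 1))
    (hxy : x < y)
    (hrow0 : (symbolRow d (b : ℚ) (mu 0) : Multiset ℚ) =
      y ::ₘ ((symbolRow d (b : ℚ) (lam 0) : Multiset ℚ).erase x))
    (hrow1 : (symbolRow d 0 (mu 1) : Multiset ℚ) =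
      x ::ₘ ((symbolRow d 0 (lam 1) : Multiset ℚ).erase y)) :
    domLT (kappa 2 d ![(b : ℚ) + 1/2, 0] lam) (kappa 2 d ![(b : ℚ) + 1/2, 0] mu) ∧
    domLT (kappa 2 d ![(b : ℚ) - 1/2, 0] mu) (kappa 2 d ![(b : ℚ) - 1/2, 0] lam) := by
  rw [Fin.sum_univ_two] at hlamn hmun
  have l0 := (hlam 0).length_le_sum
  have l1 := (hlam 1).length_le_sum
  have m0 := (hmu 0).length_le_sum
  have m1 := (hmu 1).length_le_sum
  obtain ⟨t, ht⟩ : ∃ t : ℕ, (t : ℤ) + 1 = d - (lam 0).length + b :=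
    ⟨(d - (lam 0).length + b - 1).toNat, by omega⟩
  obtain ⟨u, hu⟩ : ∃ u : ℕ, (u : ℤ) + 1 = d - (mu 0).length + b :=
    ⟨(d - (mu 0).length + b - 1).toNat, by omega⟩
  have rl : symbolRow d (b : ℚ) (lam 0) = 0 :: shiftRowTail (betaRow (lam 0)) t := by
    simpa [shiftRow_natCast_succ] using symbolRow_eq d b t 0 (lam 0) ht
  have rm : symbolRow d (b : ℚ) (mu 0) = 0 :: shiftRowTail (betaRow (mu 0)) u := by
    simpa [shiftRow_natCast_succ] using symbolRow_eq d b u 0 (mu 0) hu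
  have hnd0 := nodup_cons_shiftRowTail (lam 0) (hlam 0).1 t
  have hnd1 : (symbolRow d 0 (mu 1)).Nodup := by
    obtain ⟨s, hs⟩ : ∃ s : ℕ, (s : ℤ) + 1 = d - (mu 1).length + (0 : ℕ) :=
      ⟨(d - (mu 1).length - 1).toNat, by omega⟩
    have := symbolRow_eq d 0 s 0 (mu 1) hs
    simp only [Nat.cast_zero, add_zero, shiftRow_natCast_succ] at this
    rw [this]
    exact nodup_cons_shiftRowTail (mu 1) (hmu 1).1 s
  rw [rl] at hx hrow0
  rw [rm] at hrow0
  have hx0 : x ≠ 0 := by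
    rintro rfl
    have h0 : (0 : ℚ) ∈ y ::ₘ ((0 :: shiftRowTail (betaRow (lam 0)) t : List ℚ) :
        Multiset ℚ).erase 0 := by
      rw [← hrow0]; simp
    rw [← Multiset.cons_coe, Multiset.erase_cons_head] at h0
    rcases Multiset.mem_cons.1 h0 with h | h
    · exact hxy.ne h
    · exact (List.nodup_cons.1 hnd0).1 (by simpa using h)
  have hxt : x ∈ shiftRowTail (betaRow (lam 0)) t := (List.mem_cons.1 hx).resolve_left hx0
  obtain ⟨S, hS⟩ := Multiset.exists_cons_of_mem (Multiset.mem_coe.2 hy)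
  obtain ⟨R, hR⟩ := Multiset.exists_cons_of_mem (Multiset.mem_coe.2 hxt)
  rw [hS, Multiset.erase_cons_head] at hrow1
  have hR' : (shiftRowTail (betaRow (mu 0)) u : Multiset ℚ) = y ::ₘ R := by
    rw [← Multiset.cons_coe, ← Multiset.cons_coe, hR, Multiset.cons_swap,
      Multiset.erase_cons_head, Multiset.cons_swap] at hrow0
    exact (Multiset.cons_inj_right 0).1 hrow0
  have htpos : 0 < t := by
    rcases Nat.eq_zero_or_pos t with rfl | h
    swap
    · exact h
    exfalso
    have hnil : lam 1 = [] := (hlam 1).eq_nil_of_sum_eq_zero (by omega)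
    have hd1 : symbolRow d 0 (lam 1) = 0 :: shiftRowTail [] n := by
      have := symbolRow_eq d 0 n 0 (lam 1) (by simp [hnil]; omega)
      simpa [shiftRow_natCast_succ, hnil, betaRow] using this
    obtain ⟨k, rfl⟩ := exists_natCast_of_mem_shiftRowTail hxt
    have hxmem : ((k + 1 : ℕ) : ℚ) ∈ symbolRow d 0 (lam 1) := by
      rw [hd1] at hy ⊢
      rcases List.mem_cons.1 hy with rfl | hy
      · exact absurd hxy (not_lt.2 (Nat.cast_nonneg _))
      · simp only [shiftRowTail, List.map_nil, List.append_nil, List.mem_map, List.mem_range] at hy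
        obtain ⟨j, hj, rfl⟩ := hy
        have : k + 1 < j + 1 := by exact_mod_cast hxy
        refine List.mem_cons_of_mem _ ?_
        simp only [shiftRowTail, List.map_nil, List.append_nil, List.mem_map, List.mem_range]
        exact ⟨k, by omega, rfl⟩
    have hxS : ((k + 1 : ℕ) : ℚ) ∈ S :=
      (Multiset.mem_cons.1 (hS ▸ Multiset.mem_coe.2 hxmem)).resolve_left hxy.ne
    have : (((k + 1 : ℕ) : ℚ) ::ₘ S).Nodup := hrow1 ▸ Multiset.coe_nodup.2 hnd1
    exact (Multiset.nodup_cons.1 this).1 hxS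
  constructor
  · have pl : (symbolRow d ((b : ℚ) + 1 / 2) (lam 0) : Multiset ℚ) =
        (0 ::ₘ x ::ₘ R).map (· + 1 / 2) := by
      rw [symbolRow_eq d b t _ _ ht, shiftRow_natCast_succ_add_half, ← hR]
      simp
    have pm : (symbolRow d ((b : ℚ) + 1 / 2) (mu 0) : Multiset ℚ) =
        (0 ::ₘ y ::ₘ R).map (· + 1 / 2) := by
      rw [symbolRow_eq d b u _ _ hu, shiftRow_natCast_succ_add_half, ← hR']
      simp
    refine domLT_kappa_of_excess d _ lam mu _ _ ((coe_kappa_two _ _ _ _).trans (by rw [pl, hS]))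
      ((coe_kappa_two _ _ _ _).trans (by rw [pm, hrow1])) (by simp) (fun c => ?_)
      ⟨max (x + 1 / 2) y, ?_⟩
    · simp only [excess_add, Multiset.map_cons, excess_cons]
      have := max_add_max_le (p := x + 1 / 2) (q := y) (p' := x) (q' := y + 1 / 2) (by ring)
        (by linarith) (by linarith) c
      linarith
    · simp only [excess_add, Multiset.map_cons, excess_cons]
      have h1 := le_max_left (x + 1 / 2) y
      have h2 := le_max_right (x + 1 / 2) y
      have h3 : max (x + 1 / 2) y < y + 1 / 2 := max_lt (by linarith) (by linarith)
      generalize max (x + 1 / 2) y = c at h1 h2 h3 ⊢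
      rw [max_eq_right (a := x + 1 / 2 - c) (by linarith), max_eq_right (a := y - c) (by linarith)]
      linarith [le_max_left (y + 1 / 2 - c) 0, le_max_right (x - c) 0]
  · have pl : (symbolRow d ((b : ℚ) - 1 / 2) (lam 0) : Multiset ℚ) =
        (x ::ₘ R).map (· - 1 / 2) := by
      rw [sub_eq_add_neg, symbolRow_eq d b t _ _ ht, ← sub_eq_add_neg,
        shiftRow_natCast_succ_sub_half _ _ htpos, ← hR]
      simp
    have pm : symbolRow d ((b : ℚ) - 1 / 2) (mu 0) =
        shiftRow (betaRow (mu 0)) (u + 1 - 1 / 2) := by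
      rw [sub_eq_add_neg, symbolRow_eq d b u _ _ hu, ← sub_eq_add_neg]
    have hlen : (symbolRow d ((b : ℚ) - 1 / 2) (mu 0)).length = R.card + 1 := by
      rw [pm, length_shiftRow_sub_half, ← Multiset.coe_card, hR', Multiset.card_cons]
    have hexc (c : ℚ) : excess c (symbolRow d ((b : ℚ) - 1 / 2) (mu 0)) ≤
        excess c ((y ::ₘ R).map (· - 1 / 2)) := by
      rw [pm, ← hR']
      exact excess_shiftRow_sub_half_le c _ u
    simp only [Multiset.map_cons, excess_cons] at hexc
    refine domLT_kappa_of_excess d _ mu lam _ _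
      ((coe_kappa_two _ _ _ _).trans (by rw [hrow1]))
      ((coe_kappa_two _ _ _ _).trans (by rw [pl, hS])) 
      (by rw [Multiset.card_add, Multiset.coe_card, hlen]; simp; omega) (fun c => ?_)
      ⟨max (y - 1 / 2) x, ?_⟩
    · simp only [excess_add, Multiset.map_cons, excess_cons]
      have := max_add_max_le (p := y - 1 / 2) (q := x) (p' := x - 1 / 2) (q' := y) (by ring)
        (by linarith) (by linarith) c
      linarith [hexc c]
    · simp only [excess_add, Multiset.map_cons, excess_cons]
      have h1 := le_max_left (y - 1 / 2) x
      have h2 := le_max_right (y - 1 / 2) x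
      have h3 : max (y - 1 / 2) x < y := max_lt (by linarith) (by linarith)
      generalize max (y - 1 / 2) x = c at h1 h2 h3 ⊢
      have h4 := hexc c
      rw [max_eq_right (a := y - 1 / 2 - c) (by linarith)] at h4
      rw [max_eq_right (a := x - c) (by linarith)]
      linarith [le_max_left (y - c) 0, le_max_right (x - 1 / 2 - c) 0]
end
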